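/- arXiv:2405.10617 — 3 statements merged into one kernel-verified Lean document; each statement's English description precedes it below -/
import Mathlib

section
/- Let (W,S) be a 2-spherical Coxeter system of finite rank n ≥ 4 whose Coxeter diagram is the complete graph. Then for every i ∈ ℕ one has (n-2)·c_i ≤ d_i + d_{i+1}. -/
namespace CoxAux

open CoxeterSystem

variable {B : Type*} {W : Type*} [Group W] {M : CoxeterMatrix B} (cs : CoxeterSystem M W)

open Classical in
/-- The action of a simple reflection on `W × ZMod 2`. -/
noncomputable def act (i : B) : Function.End (W × ZMod 2) :=
  fun p => (cs.simple i * p.1 * cs.simple i, p.2 + if p.1 = cs.simple i then 1 else 0)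

open Classical in
theorem act_pow (i j : B) (k : ℕ) (t : W) (e : ZMod 2) :
    ((act cs i * act cs j) ^ k : Function.End (W × ZMod 2)) (t, e) =
      ((cs.simple i * cs.simple j) ^ k * t * ((cs.simple i * cs.simple j) ^ k)⁻¹,
        e + ∑ l ∈ Finset.range (2 * k),
          if t = (cs.simple j * cs.simple i) ^ l * cs.simple j then 1 else 0) := by
  induction k with
  | zero => simp; rfl
  | succ k ih =>
    have hinv : (cs.simple i * cs.simple j)⁻¹ = cs.simple j * cs.simple i := by simp
    have hk : ((cs.simple i * cs.simple j) ^ k)⁻¹ = (cs.simple j * cs.simple i) ^ k := by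
      rw [← inv_pow, hinv]
    have hsw : cs.simple j * (cs.simple i * cs.simple j) ^ k
        = (cs.simple j * cs.simple i) ^ k * cs.simple j := by
      have : SemiconjBy (cs.simple j) (cs.simple i * cs.simple j)
        (cs.simple j * cs.simple i) := by simp [SemiconjBy, mul_assoc]
      exact (this.pow_right k)
    have h1 : ((cs.simple i * cs.simple j) ^ k * t * ((cs.simple i * cs.simple j) ^ k)⁻¹
        = cs.simple j) ↔ t = (cs.simple j * cs.simple i) ^ (2 * k) * cs.simple j := by
      rw [mul_inv_eq_iff_eq_mul, ← eq_inv_mul_iff_mul_eq, hsw, hk, ← mul_assoc, two_mul, pow_add]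
    have h2 : (cs.simple j * ((cs.simple i * cs.simple j) ^ k * t *
        ((cs.simple i * cs.simple j) ^ k)⁻¹) * cs.simple j
        = cs.simple i) ↔ t = (cs.simple j * cs.simple i) ^ (2 * k + 1) * cs.simple j := by
      have h3 : (cs.simple j * ((cs.simple i * cs.simple j) ^ k * t *
        ((cs.simple i * cs.simple j) ^ k)⁻¹) * cs.simple j
        = cs.simple i) ↔ ((cs.simple i * cs.simple j) ^ k * t *
        ((cs.simple i * cs.simple j) ^ k)⁻¹) = cs.simple j * cs.simple i * cs.simple j := by
        generalize (cs.simple i * cs.simple j) ^ k * t *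
          ((cs.simple i * cs.simple j) ^ k)⁻¹ = x
        constructor
        · intro h; rw [← h]; simp [mul_assoc]
        · intro h; rw [h]; simp [mul_assoc]
      rw [h3, mul_inv_eq_iff_eq_mul, ← eq_inv_mul_iff_mul_eq, mul_assoc _ (cs.simple j), hsw, hk,
        ← mul_assoc, ← mul_assoc, ← pow_succ, ← pow_add]
      rw [show k + 1 + k = 2 * k + 1 by ring] 
    rw [pow_succ']
    change (act cs i * act cs j) (((act cs i * act cs j) ^ k : Function.End (W × ZMod 2)) (t, e)) = _
    rw [ih]
    change act cs i (act cs j _) = _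
    simp only [act]
    rw [show 2 * (k + 1) = 2 * k + 1 + 1 by ring, Finset.sum_range_succ, Finset.sum_range_succ]
    simp only [h1, h2]
    refine Prod.ext ?_ ?_
    · simp [pow_succ', mul_assoc]
    · simp [add_assoc]

theorem act_liftable : M.IsLiftable (act cs) := by
  classical
  intro i j
  funext ⟨t, e⟩
  rw [act_pow]
  have h := cs.simple_mul_simple_pow i j
  have h' := cs.simple_mul_simple_pow' i j
  rw [two_mul, Finset.sum_range_add]
  simp only [pow_add, h, h', one_mul]
  rw [CharTwo.add_self_eq_zero]
  simp [Function.End.one_def]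

/-- The lifted action. -/
noncomputable def phi : W →* Function.End (W × ZMod 2) := cs.lift ⟨act cs, act_liftable cs⟩

open Classical in
theorem phi_wordProd (ω : List B) (t : W) (e : ZMod 2) :
    phi cs (cs.wordProd ω) (t, e) = (cs.wordProd ω * t * (cs.wordProd ω)⁻¹,
      e + ((cs.rightInvSeq ω).count t : ZMod 2)) := by
  induction ω with
  | nil => simp [Function.End.one_def]
  | cons i ω ih =>
    rw [cs.wordProd_cons, map_mul]
    change phi cs (cs.simple i) (phi cs (cs.wordProd ω) (t, e)) = _
    rw [ih]
    have : phi cs (cs.simple i) = act cs i := cs.lift_apply_simple (act_liftable cs) i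
    rw [this]
    simp only [act, rightInvSeq, List.count_cons]
    have h : (cs.wordProd ω * t * (cs.wordProd ω)⁻¹ = cs.simple i) ↔
        ((cs.wordProd ω)⁻¹ * cs.simple i * cs.wordProd ω = t) := by
      constructor
      · intro h; rw [← h]; group
      · intro h; rw [← h]; group
    refine Prod.ext ?_ ?_
    · simp [mul_assoc]
    · simp [h, add_assoc]

theorem mem_ris {ω : List B} (hω : cs.IsReduced ω) (s : B)
    (hs : cs.length (cs.wordProd ω * cs.simple s) < cs.length (cs.wordProd ω)) :
    cs.simple s ∈ cs.rightInvSeq ω := by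
  classical
  by_contra hn
  obtain ⟨ω', hω', he⟩ := cs.exists_isReduced (cs.wordProd ω * cs.simple s)
  have h1 := phi_wordProd cs ω' (cs.simple s) 0
  have h2 : phi cs (cs.wordProd ω * cs.simple s) (cs.simple s, 0)
      = phi cs (cs.wordProd ω) (cs.simple s, 1) := by
    rw [map_mul]
    change phi cs (cs.wordProd ω) (phi cs (cs.simple s) (cs.simple s, 0)) = _
    have : phi cs (cs.simple s) = act cs s := cs.lift_apply_simple (act_liftable cs) s
    rw [this]; simp [act]
  rw [← he, h2, phi_wordProd, List.count_eq_zero_of_not_mem hn] at h1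
  have h3 := congrArg Prod.snd h1
  simp only [Nat.cast_zero, add_zero, zero_add] at h3
  have hmem : cs.simple s ∈ cs.rightInvSeq ω' := by
    by_contra hh
    rw [List.count_eq_zero_of_not_mem hh] at h3
    exact absurd h3 (by decide)
  have h4 := (cs.isRightInversion_of_mem_rightInvSeq hω' hmem).2
  rw [← he] at h4
  simp at h4
  omega

/-- Exchange property. -/
theorem exchange {ω : List B} (hω : cs.IsReduced ω) (s : B)
    (hs : cs.length (cs.wordProd ω * cs.simple s) < cs.length (cs.wordProd ω)) :
    ∃ j < ω.length, cs.wordProd ω * cs.simple s = cs.wordProd (ω.eraseIdx j) := by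
  obtain ⟨j, hj, he⟩ := List.getElem_of_mem (mem_ris cs hω s hs)
  have := cs.wordProd_mul_getD_rightInvSeq ω j
  rw [List.getD_eq_getElem _ _ hj, he] at this
  exact ⟨j, by simpa using hj, this⟩

/-- exchange for `w = x * u`, in element form. -/
theorem exch1 (x : W) (t u : B) (hx : cs.length (x * cs.simple t) = cs.length x + 1)
    (hu : cs.length (x * cs.simple t * cs.simple u) < cs.length (x * cs.simple t)) :
    x * cs.simple t * cs.simple u = x ∨
      ∃ y, cs.length y < cs.length x ∧ x * cs.simple t * cs.simple u = y * cs.simple t := by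
  obtain ⟨ω, hω, rfl⟩ := cs.exists_isReduced x
  have hr : cs.IsReduced (ω ++ [t]) := by
    unfold CoxeterSystem.IsReduced; rw [wordProd_append]; simp [hx, hω.eq]
  obtain ⟨j, hj, he⟩ := exchange cs hr u (by simpa [wordProd_append] using hu)
  simp only [wordProd_append, wordProd_singleton] at he
  rcases Nat.lt_or_ge j ω.length with h | h
  · right
    rw [List.eraseIdx_append_of_lt_length h, wordProd_append, wordProd_singleton] at he
    refine ⟨_, ?_, he⟩
    have := cs.length_wordProd_le (ω.eraseIdx j)
    rw [List.length_eraseIdx_of_lt h] at this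
    rw [hω.eq]; omega
  · left
    have : j = ω.length := by simp at hj; omega
    subst this
    rw [he]; simp [List.eraseIdx_append_of_length_le]

theorem exch2 (x : W) (u t : B)
    (hx : cs.length (x * cs.simple u * cs.simple t) = cs.length x + 2)
    (hu : cs.length (x * cs.simple u * cs.simple t * cs.simple u)
      < cs.length (x * cs.simple u * cs.simple t)) :
    x * cs.simple u * cs.simple t * cs.simple u = x * cs.simple u ∨
    x * cs.simple u * cs.simple t * cs.simple u = x * cs.simple t ∨
      ∃ y, cs.length y < cs.length x ∧
        x * cs.simple u * cs.simple t * cs.simple u = y * cs.simple u * cs.simple t := by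
  obtain ⟨ω, hω, rfl⟩ := cs.exists_isReduced x
  have hr : cs.IsReduced (ω ++ [u, t]) := by
    unfold CoxeterSystem.IsReduced; rw [wordProd_append]; simp [wordProd_cons, ← mul_assoc, hx, hω.eq]
  obtain ⟨j, hj, he⟩ := exchange cs hr u
    (by simpa [wordProd_append, wordProd_cons, ← mul_assoc] using hu)
  simp only [wordProd_append, wordProd_cons, wordProd_nil, mul_one, ← mul_assoc] at he
  rcases Nat.lt_or_ge j ω.length with h | h
  · right; right
    rw [List.eraseIdx_append_of_lt_length h, wordProd_append] at he
    simp only [wordProd_cons, wordProd_nil, mul_one, ← mul_assoc] at he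
    refine ⟨_, ?_, he⟩
    have := cs.length_wordProd_le (ω.eraseIdx j)
    rw [List.length_eraseIdx_of_lt h] at this
    rw [hω.eq]; omega
  · simp at hj
    rw [List.eraseIdx_append_of_length_le h, wordProd_append] at he
    have : j = ω.length ∨ j = ω.length + 1 := by omega
    rcases this with rfl | rfl
    · right; left
      simpa using he
    · left
      simpa using he

theorem simple_ne
    (hcomp : ∀ s t : B, s ≠ t → 3 ≤ orderOf (cs.simple s * cs.simple t))
    {t u : B} (h : t ≠ u) : cs.simple t ≠ cs.simple u := by
  intro e
  have := hcomp t u h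
  rw [e, cs.simple_mul_simple_self, orderOf_one] at this
  omega

theorem two_desc
    (hcomp : ∀ s t : B, s ≠ t → 3 ≤ orderOf (cs.simple s * cs.simple t))
    {v : W} {t u : B} (h : t ≠ u) (ht : cs.IsRightDescent v t)
    (hu : cs.IsRightDescent v u) : cs.IsRightDescent (v * cs.simple t) u := by
  rw [cs.isRightDescent_iff] at ht
  unfold IsRightDescent at hu ⊢
  have := exch1 cs (v * cs.simple u) u t
  have hu' := hu
  rw [← IsRightDescent, cs.isRightDescent_iff] at hu'
  simp only [cs.simple_mul_simple_cancel_right] at this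
  rcases this hu'.symm (by omega) with h1 | ⟨y, hy, h1⟩
  · exact absurd (mul_left_cancel h1) (simple_ne cs hcomp h)
  · rw [h1]
    simp only [cs.simple_mul_simple_cancel_right]
    rw [← h1]; omega

theorem three_desc
    (hcomp : ∀ s t : B, s ≠ t → 3 ≤ orderOf (cs.simple s * cs.simple t))
    {v : W} {t u : B} (h : t ≠ u) (ht : cs.IsRightDescent v t)
    (hu : cs.IsRightDescent v u) :
    cs.IsRightDescent (v * cs.simple t * cs.simple u) t := by
  have h1 := two_desc cs hcomp h.symm hu ht
  have h2 := two_desc cs hcomp h ht hu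
  rw [cs.isRightDescent_iff] at ht hu h1 h2
  have := exch2 cs (v * cs.simple u * cs.simple t) t u
  simp only [cs.simple_mul_simple_cancel_right] at this
  rcases this (by omega) (by omega) with h3 | h3 | ⟨y, hy, h3⟩
  · exact absurd (mul_left_cancel h3) (simple_ne cs hcomp h)
  · exfalso
    have h4 : cs.simple t = cs.simple u * cs.simple t * cs.simple u := by
      apply mul_left_cancel (a := v)
      rw [h3]; simp only [mul_assoc]
    have h5 : (cs.simple t * cs.simple u) ^ 2 = 1 := by
      rw [pow_two]
      nth_rewrite 1 [h4]
      simp [mul_assoc]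
    have := orderOf_le_of_pow_eq_one (by norm_num) h5
    have := hcomp t u h
    omega
  · unfold IsRightDescent
    rw [h3]
    simp only [cs.simple_mul_simple_cancel_right]
    rw [← cs.simple_mul_simple_cancel_right (w := y) t] at hy
    have h6 : v * cs.simple t * cs.simple u = y * cs.simple t := by
      rw [h3]; simp
    have h7 : cs.length (v * cs.simple t * cs.simple u) + 2 = cs.length v := by omega
    rw [h6] at h7
    simp only [cs.simple_mul_simple_cancel_right] at hy
    omega

theorem star
    (hcomp : ∀ s t : B, s ≠ t → 3 ≤ orderOf (cs.simple s * cs.simple t))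
    (k : ℕ) : ∀ (v : W) (t u s : B), cs.length v = k → t ≠ u → s ≠ t → s ≠ u →
    cs.IsRightDescent v t → cs.IsRightDescent v u →
    ¬ cs.IsRightDescent (v * cs.simple t) s := by
  induction k with
  | zero =>
    intro v t u s hv _ _ _ ht
    unfold IsRightDescent at ht
    omega
  | succ k ih =>
    intro v t u s hv htu hst hsu ht hu hs
    have h1 := two_desc cs hcomp htu ht hu
    have h2 := three_desc cs hcomp htu ht hu
    rw [cs.isRightDescent_iff] at ht
    exact ih (v * cs.simple t) u s t (by omega) hsu.symm htu hst.symm h1 hs h2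

variable [Fintype B]

open Classical in
/-- right descents -/
noncomputable def desc {B : Type*} [Fintype B] {W : Type*} [Group W] {M : CoxeterMatrix B}
    (cs : CoxeterSystem M W) (w : W) : Finset B :=
  Finset.univ.filter fun s => cs.length (w * cs.simple s) < cs.length w

theorem mem_desc (w : W) (s : B) : s ∈ desc cs w ↔ cs.IsRightDescent w s := by
  simp [desc, IsRightDescent]

theorem card_desc_le
    (hcomp : ∀ s t : B, s ≠ t → 3 ≤ orderOf (cs.simple s * cs.simple t))
    (w : W) : (desc cs w).card ≤ 2 := by
  by_contra! h
  obtain ⟨a, ha, b, hb, c, hc, hab, hac, hbc⟩ := Finset.two_lt_card.1 h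
  rw [mem_desc] at ha hb hc
  exact star cs hcomp _ w a b c rfl hab hac.symm hbc.symm ha hb (two_desc cs hcomp hac ha hc)

theorem desc_mul
    (hcomp : ∀ s t : B, s ≠ t → 3 ≤ orderOf (cs.simple s * cs.simple t))
    {w : W} {s : B} (h2 : (desc cs w).card = 2) (hs : s ∈ desc cs w) :
    ∃ t, t ≠ s ∧ t ∈ desc cs w ∧ desc cs (w * cs.simple s) = {t} ∧
      s ∈ desc cs (w * cs.simple s * cs.simple t) := by
  classical
  obtain ⟨t, ht, hts⟩ := Finset.exists_mem_ne (by omega : 1 < (desc cs w).card) s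
  refine ⟨t, hts, ht, ?_, ?_⟩
  · rw [mem_desc] at hs ht
    ext r
    rw [mem_desc, Finset.mem_singleton]
    constructor
    · intro hr
      by_contra hrt
      by_cases hrs : r = s
      · subst hrs
        exact (cs.isRightDescent_iff_not_isRightDescent_mul.1 hs) hr
      · exact star cs hcomp _ w s t r rfl hts.symm hrs hrt hs ht hr
    · rintro rfl
      exact two_desc cs hcomp hts.symm hs ht
  · rw [mem_desc] at *
    exact three_desc cs hcomp hts.symm hs ht

theorem finite_len (i : ℕ) : {w : W | cs.length w = i}.Finite := by
  refine ((List.finite_length_eq B i).image cs.wordProd).subset ?_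
  intro w hw
  obtain ⟨ω, hω, rfl⟩ := cs.exists_isReduced w
  exact ⟨ω, hω.eq.symm.trans hw, rfl⟩

/-- the sphere -/
noncomputable def sph {B : Type*} [Fintype B] {W : Type*} [Group W] {M : CoxeterMatrix B}
    (cs : CoxeterSystem M W) (i : ℕ) : Finset W := (finite_len cs i).toFinset

theorem mem_sph (i : ℕ) (w : W) : w ∈ sph cs i ↔ cs.length w = i := by simp [sph]

theorem sum_up (i : ℕ) :
    ∑ w ∈ sph cs i, (Fintype.card B - (desc cs w).card) =
      ∑ w ∈ sph cs (i + 1), (desc cs w).card := by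
  classical
  simp only [← Finset.card_compl]
  rw [← Finset.card_sigma, ← Finset.card_sigma]
  refine Finset.card_bij' (fun p _ => ⟨p.1 * cs.simple p.2, p.2⟩)
    (fun p _ => ⟨p.1 * cs.simple p.2, p.2⟩) ?_ ?_ ?_ ?_
  · rintro ⟨w, s⟩ h
    simp only [Finset.mem_sigma, mem_sph, Finset.mem_compl, mem_desc,
      cs.not_isRightDescent_iff] at h ⊢
    rw [cs.isRightDescent_iff]
    simp only [cs.simple_mul_simple_cancel_right]
    omega
  · rintro ⟨w, s⟩ h
    simp only [Finset.mem_sigma, mem_sph, Finset.mem_compl, mem_desc,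
      cs.not_isRightDescent_iff, cs.isRightDescent_iff] at h ⊢
    simp only [cs.simple_mul_simple_cancel_right]
    omega
  · rintro ⟨w, s⟩ h; simp
  · rintro ⟨w, s⟩ h; simp

theorem e_le_d
    (hcomp : ∀ s t : B, s ≠ t → 3 ≤ orderOf (cs.simple s * cs.simple t))
    (i : ℕ) :
    ((sph cs (i + 1)).filter fun w => (desc cs w).card = 2).card ≤
      ((sph cs i).filter fun w => (desc cs w).card = 1).card := by
  classical
  set E := (sph cs (i + 1)).filter fun w => (desc cs w).card = 2
  set D := (sph cs i).filter fun w => (desc cs w).card = 1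
  have h1 : (E.sigma (desc cs)).card = 2 * E.card := by
    rw [Finset.card_sigma, Finset.sum_congr rfl (g := fun _ => 2)]
    · simp [mul_comm]
    · intro w hw; exact (Finset.mem_filter.1 hw).2
  have h2 : (E.sigma (desc cs)).card ≤ 2 * D.card := by
    refine Finset.card_le_mul_card_image_of_maps_to
      (f := fun p : (Σ _ : W, B) => p.1 * cs.simple p.2) ?_ 2 ?_
    · rintro ⟨w, s⟩ h
      simp only [Finset.mem_sigma, E, Finset.mem_filter, mem_sph] at h
      obtain ⟨⟨hl, hc⟩, hs⟩ := h
      obtain ⟨t, -, -, ht, -⟩ := desc_mul cs hcomp hc hs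
      rw [mem_desc, cs.isRightDescent_iff] at hs
      simp only [D, Finset.mem_filter, mem_sph]
      refine ⟨by omega, ?_⟩
      rw [ht]; simp
    · intro v hv
      simp only [D, Finset.mem_filter, mem_sph] at hv
      obtain ⟨t, ht⟩ := Finset.card_eq_one.1 hv.2
      refine le_trans ?_ (card_desc_le cs hcomp (v * cs.simple t))
      refine Finset.card_le_card_of_injOn (fun p => p.2) ?_ ?_
      · rintro ⟨w, s⟩ h
        simp only [Finset.coe_filter, Set.mem_ofPred_eq, Finset.mem_sigma, E,
          Finset.mem_filter, mem_sph] at h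
        obtain ⟨⟨⟨hl, hc⟩, hs⟩, rfl⟩ := h
        obtain ⟨t', -, -, ht', hh⟩ := desc_mul cs hcomp hc hs
        rw [ht'] at ht
        rw [Finset.singleton_inj] at ht
        subst ht
        exact hh
      · rintro ⟨w, s⟩ h ⟨w', s'⟩ h' hss
        simp only [Finset.coe_filter, Set.mem_ofPred_eq] at h h' hss
        subst hss
        have := mul_right_cancel (h.2.trans h'.2.symm)
        subst this
        rfl
  omega

end CoxAux

/-- Let `(W, S)` be a `2`-spherical Coxeter system of finite rank `n ≥ 4` whose Coxeter
diagram is the complete graph. Let `c i` be the number of elements of length `i` and `d i`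
the number of elements of length `i` with exactly one right descent. Then for every `i ∈ ℕ`
one has `(n - 2) * c i ≤ d i + d (i+1)`. -/
theorem c_le_d_add_d_succ
    {B : Type*} [Fintype B] {W : Type*} [Group W] {M : CoxeterMatrix B}
    (cs : CoxeterSystem M W) (n : ℕ) (hn : Fintype.card B = n) (hn4 : 4 ≤ n)
    (h2sph : ∀ s t : B, orderOf (cs.simple s * cs.simple t) ≠ 0)
    (hcomp : ∀ s t : B, s ≠ t → 3 ≤ orderOf (cs.simple s * cs.simple t))
    (c d : ℕ → ℕ)
    (hc : ∀ i, c i = Nat.card {w : W // cs.length w = i})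
    (hd : ∀ i, d i = Nat.card {w : W // cs.length w = i ∧
      ∃! s : B, cs.length (w * cs.simple s) < cs.length w})
    (i : ℕ) :
    (n - 2) * c i ≤ d i + d (i + 1) := by
  classical
  subst hn
  have hcc : ∀ i, c i = (CoxAux.sph cs i).card := by
    intro i
    rw [hc i, Nat.subtype_card]
    exact fun w => CoxAux.mem_sph cs i w
  have hdd : ∀ i, d i = ((CoxAux.sph cs i).filter
      fun w => (CoxAux.desc cs w).card = 1).card := by
    intro i
    rw [hd i, Nat.subtype_card]
    intro w
    rw [Finset.mem_filter, CoxAux.mem_sph, Finset.card_eq_one_iff_existsUnique]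
    simp only [CoxAux.mem_desc, CoxeterSystem.IsRightDescent]
  have key := CoxAux.sum_up cs i
  have hle := CoxAux.card_desc_le cs hcomp
  have hsum : ∀ i, 1 ≤ i → c i = d i + ((CoxAux.sph cs i).filter
      fun w => (CoxAux.desc cs w).card = 2).card := by
    intro i hi
    rw [hcc, hdd, ← Finset.card_union_of_disjoint, ← Finset.filter_or, Finset.filter_true_of_mem]
    · intro w hw
      rw [CoxAux.mem_sph] at hw
      have h0 : w ≠ 1 := by
        rintro rfl
        simp at hw
        omega
      obtain ⟨s, hs⟩ := cs.exists_rightDescent_of_ne_one h0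
      have := Finset.card_pos.2 ⟨s, (CoxAux.mem_desc cs w s).2 hs⟩
      have := hle w
      omega
    · exact Finset.disjoint_filter.2 fun w _ h1 h2 => by omega
  have hD : ∀ i, ∑ w ∈ CoxAux.sph cs i, (CoxAux.desc cs w).card = d i +
      2 * ((CoxAux.sph cs i).filter fun w => (CoxAux.desc cs w).card = 2).card := by
    intro i
    rw [hdd, Finset.card_filter, Finset.card_filter, Finset.mul_sum, ← Finset.sum_add_distrib]
    refine Finset.sum_congr rfl fun w _ => ?_
    have := hle w
    split_ifs <;> omega
  have hadd : ∑ w ∈ CoxAux.sph cs i, (Fintype.card B - (CoxAux.desc cs w).card) +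
      ∑ w ∈ CoxAux.sph cs i, (CoxAux.desc cs w).card = Fintype.card B * c i := by
    rw [← Finset.sum_add_distrib, Finset.sum_congr rfl (g := fun _ => Fintype.card B)]
    · rw [Finset.sum_const, hcc, smul_eq_mul, mul_comm]
    · intro w _
      exact Nat.sub_add_cancel (Finset.card_le_univ _)
  rw [key, hD, hD] at hadd
  rw [Nat.sub_mul]
  have hE := CoxAux.e_le_d cs hcomp i
  rw [← hdd] at hE
  rcases Nat.eq_zero_or_pos i with rfl | hi
  · have he1 : ((CoxAux.sph cs (0 + 1)).filter
        fun w => (CoxAux.desc cs w).card = 2).card ≤ d 0 := hE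
    have hd0 : d 0 = 0 := by
      rw [hdd, Finset.card_eq_zero, Finset.filter_eq_empty_iff]
      intro w hw h
      rw [CoxAux.mem_sph, cs.length_eq_zero_iff] at hw
      subst hw
      obtain ⟨s, hs⟩ := Finset.card_pos.1 (by omega : 0 < (CoxAux.desc cs 1).card)
      exact cs.not_isRightDescent_one s ((CoxAux.mem_desc cs 1 s).1 hs)
    have he0 : ((CoxAux.sph cs 0).filter
        fun w => (CoxAux.desc cs w).card = 2).card = 0 := by
      rw [Finset.card_eq_zero, Finset.filter_eq_empty_iff]
      intro w hw h
      rw [CoxAux.mem_sph, cs.length_eq_zero_iff] at hw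
      subst hw
      obtain ⟨s, hs⟩ := Finset.card_pos.1 (by omega : 0 < (CoxAux.desc cs 1).card)
      exact cs.not_isRightDescent_one s ((CoxAux.mem_desc cs 1 s).1 hs)
    omega
  · have := hsum i hi
    omega
end

section
/- Let (W,S) be a 2-spherical Coxeter system whose Coxeter diagram is the complete graph. Let R = a·⟨s,t⟩ and T = b·⟨u,v⟩ be two distinct residues of rank 2 (a,b ∈ W, s ≠ t ∈ S, u ≠ v ∈ S) such that P := R ∩ T is a panel, i.e. P = c·⟨r⟩ for some c ∈ W and r ∈ S. Assume that min{ℓ(x) : x ∈ R} < min{ℓ(x) : x ∈ T}. Then for every x ∈ T of minimal length in T and every y ∈ P of minimal length in P one has x = y; in particular the minimal-length element of T lies in P. -/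
namespace ProjAux

open CoxeterSystem

variable {B : Type*} {W : Type*} [Group W] {M : CoxeterMatrix B} (cs : CoxeterSystem M W)

open Classical in
/-- The involution of `W × ZMod 2` attached to a simple reflection. -/
noncomputable def rho (i : B) : Equiv.Perm (W × ZMod 2) where
  toFun p := (cs.simple i * p.1 * cs.simple i, p.2 + if p.1 = cs.simple i then 1 else 0)
  invFun p := (cs.simple i * p.1 * cs.simple i, p.2 + if p.1 = cs.simple i then 1 else 0)
  left_inv := by
    rintro ⟨t, e⟩
    have h : cs.simple i * t * cs.simple i = cs.simple i ↔ t = cs.simple i := by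
      constructor
      · intro h
        have := congrArg (fun z => cs.simple i * z * cs.simple i) h
        simpa [mul_assoc] using this
      · rintro rfl; simp
    have h2 : (1 + 1 : ZMod 2) = 0 := by decide
    by_cases ht : t = cs.simple i
    · simp [ht, add_assoc, h2]
    · simp only [h, ht, if_false, add_zero]
      simp [mul_assoc]
  right_inv := by
    rintro ⟨t, e⟩
    have h : cs.simple i * t * cs.simple i = cs.simple i ↔ t = cs.simple i := by
      constructor
      · intro h
        have := congrArg (fun z => cs.simple i * z * cs.simple i) h
        simpa [mul_assoc] using this
      · rintro rfl; simp
    have h2 : (1 + 1 : ZMod 2) = 0 := by decide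
    by_cases ht : t = cs.simple i
    · simp [ht, add_assoc, h2]
    · simp only [h, ht, if_false, add_zero]
      simp [mul_assoc]

open Classical in
lemma rho_apply (i : B) (t : W) (e : ZMod 2) :
    rho cs i (t, e) = (cs.simple i * t * cs.simple i, e + if t = cs.simple i then 1 else 0) := rfl

lemma pow_conj (i j : B) (k : ℕ) :
    (cs.simple i * cs.simple j) ^ k * cs.simple j * (cs.simple i * cs.simple j) ^ k
      = cs.simple j := by
  induction k with
  | zero => simp
  | succ k ih =>
    calc _ = (cs.simple i * cs.simple j) * ((cs.simple i * cs.simple j) ^ k * cs.simple j *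
              (cs.simple i * cs.simple j) ^ k) * (cs.simple i * cs.simple j) := by
            conv_lhs => rw [pow_succ' _ k]
            have : cs.simple i * cs.simple j * (cs.simple i * cs.simple j) ^ k =
              (cs.simple i * cs.simple j) ^ k * (cs.simple i * cs.simple j) := by
              rw [← pow_succ, pow_succ']
            nth_rewrite 2 [this]
            simp only [mul_assoc]
      _ = _ := by rw [ih]; simp [mul_assoc]

open Classical in
lemma rho_pow (i j : B) (n : ℕ) (t : W) (e : ZMod 2) :
    ((rho cs i * rho cs j) ^ n) (t, e) =
      ((cs.simple i * cs.simple j) ^ n * t * ((cs.simple i * cs.simple j) ^ n)⁻¹,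
        e + ∑ k ∈ Finset.range (2 * n),
          if t = cs.simple j * (cs.simple i * cs.simple j) ^ k then 1 else 0) := by
  induction n with
  | zero => simp
  | succ n ih =>
    rw [pow_succ', Equiv.Perm.mul_apply, ih, Equiv.Perm.mul_apply, rho_apply, rho_apply]
    set g := cs.simple i * cs.simple j with hg
    have hc := pow_conj cs i j n
    rw [← hg] at hc
    have h1 : g ^ n * t * (g ^ n)⁻¹ = cs.simple j ↔ t = cs.simple j * g ^ (2 * n) := by
      constructor
      · intro h
        have h' : g ^ n * t = cs.simple j * g ^ n := by rw [← h]; group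
        have h3 : g ^ n * (cs.simple j * g ^ (2 * n)) = cs.simple j * g ^ n := by
          rw [two_mul, pow_add, ← mul_assoc, ← mul_assoc, hc]
        exact mul_left_cancel (h'.trans h3.symm)
      · rintro rfl
        rw [two_mul, pow_add, ← mul_assoc, ← mul_assoc, hc]; group
    have h2 : cs.simple j * (g ^ n * t * (g ^ n)⁻¹) * cs.simple j = cs.simple i ↔
        t = cs.simple j * g ^ (2 * n + 1) := by
      have h3 : g ^ n * (cs.simple j * g ^ (2 * n + 1)) = cs.simple j * g * g ^ n := by
        rw [show 2 * n + 1 = n + (1 + n) by ring, pow_add, pow_add, pow_one, ← mul_assoc,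
          ← mul_assoc, hc]
        simp only [mul_assoc]
      constructor
      · intro h
        have h' : g ^ n * t = cs.simple j * g * g ^ n := by
          have h5 : cs.simple j * g = g ^ n * t * (g ^ n)⁻¹ := by
            have e : cs.simple j * g = cs.simple j * cs.simple i * cs.simple j := by
              rw [hg, mul_assoc]
            rw [e, ← h]; simp [mul_assoc]
          rw [h5]; group
        exact mul_left_cancel (h'.trans h3.symm)
      · rintro rfl
        rw [h3, mul_inv_cancel_right, hg]; simp [mul_assoc]
    have e2 : 2 * (n + 1) = 2 * n + 1 + 1 := by ring
    rw [e2, Finset.sum_range_succ, Finset.sum_range_succ]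
    ext
    · simp only [hg, pow_succ', mul_inv_rev, inv_simple, mul_assoc]
    · simp only [h1, h2, add_assoc]

lemma rho_liftable : M.IsLiftable (rho cs) := by
  classical
  intro i j
  ext1 ⟨t, e⟩
  rw [rho_pow]
  have h : (cs.simple i * cs.simple j) ^ (M i j) = 1 := cs.simple_mul_simple_pow i j
  rw [h, two_mul, Finset.sum_range_add]
  simp only [pow_add, h, one_mul, inv_one, mul_one]
  rw [CharTwo.add_self_eq_zero]
  simp

/-- The lifted action. -/
noncomputable def act : W →* Equiv.Perm (W × ZMod 2) := cs.lift ⟨rho cs, rho_liftable cs⟩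

lemma act_simple (i : B) : act cs (cs.simple i) = rho cs i := cs.lift_apply_simple _ _

open Classical in
lemma act_word (ω : List B) (t : W) (e : ZMod 2) :
    act cs (cs.wordProd ω) (t, e) =
      (cs.wordProd ω * t * (cs.wordProd ω)⁻¹, e + (List.count t (cs.rightInvSeq ω) : ℕ)) := by
  induction ω with
  | nil => simp
  | cons i ω ih =>
    rw [wordProd_cons, map_mul, Equiv.Perm.mul_apply, ih, act_simple, rho_apply]
    have h : cs.wordProd ω * t * (cs.wordProd ω)⁻¹ = cs.simple i ↔
        (cs.wordProd ω)⁻¹ * cs.simple i * cs.wordProd ω = t := by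
      constructor
      · intro h; rw [← h]; group
      · intro h; rw [← h]; group
    rw [rightInvSeq, List.count_cons]
    ext
    · simp [mul_assoc]
    · simp [h, add_assoc]

/-- Exchange condition. -/
lemma exchange (ω : List B) (i : B) (h : cs.length (cs.wordProd ω * cs.simple i) <
    cs.length (cs.wordProd ω)) :
    ∃ k < ω.length, cs.wordProd ω * cs.simple i = cs.wordProd (ω.eraseIdx k) := by
  classical
  have key : cs.simple i ∈ cs.rightInvSeq ω := by
    by_contra hn
    have h0 : (act cs (cs.wordProd ω) (cs.simple i, 0)).2 = 0 := by
      rw [act_word, List.count_eq_zero_of_not_mem hn]; simp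
    obtain ⟨α, hα, hw⟩ := cs.exists_isReduced (cs.wordProd ω * cs.simple i)
    have h1 : (act cs (cs.wordProd ω * cs.simple i) (cs.simple i, 0)).2 = 1 := by
      have : cs.wordProd ω * cs.simple i = cs.wordProd (ω ++ [i]) := by simp [wordProd_append]
      rw [map_mul, Equiv.Perm.mul_apply, act_simple, rho_apply, act_word]
      simp [List.count_eq_zero_of_not_mem hn]
    rw [hw, act_word] at h1
    have hm : cs.simple i ∈ cs.rightInvSeq α := by
      by_contra hm
      rw [List.count_eq_zero_of_not_mem hm] at h1
      simp at h1
    have := (cs.isRightInversion_of_mem_rightInvSeq hα hm).2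
    rw [← hw] at this
    simp at this
    omega
  obtain ⟨k, hk, hkk⟩ := List.mem_iff_getElem.mp key
  refine ⟨k, by simpa using hk, ?_⟩
  rw [← cs.wordProd_mul_getD_rightInvSeq, List.getD_eq_getElem _ _ hk, hkk]

/-- Words in `J` can be shortened when lengths do not add. -/
lemma shorten (J : Set B) (y : W)
    (hy : ∀ ω : List B, (∀ i ∈ ω, i ∈ J) → cs.length y ≤ cs.length (y * cs.wordProd ω))
    (ω : List B) (hω : ∀ i ∈ ω, i ∈ J)
    (hlt : cs.length (y * cs.wordProd ω) < cs.length y + ω.length) :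
    ∃ ω' : List B, (∀ i ∈ ω', i ∈ J) ∧ cs.wordProd ω' = cs.wordProd ω ∧
      ω'.length < ω.length := by
  induction ω using List.reverseRecOn with
  | nil => simp at hlt
  | append_singleton ω i ih =>
    have hω1 : ∀ j ∈ ω, j ∈ J := fun j hj => hω j (by simp [hj])
    have hi : i ∈ J := hω i (by simp)
    by_cases hc : cs.length (y * cs.wordProd ω) < cs.length y + ω.length
    · obtain ⟨ω', h1, h2, h3⟩ := ih hω1 hc
      refine ⟨ω' ++ [i], ?_, by simp [wordProd_append, h2], by simpa using h3⟩
      intro j hj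
      rcases List.mem_append.mp hj with hj | hj
      · exact h1 j hj
      · simp at hj; rwa [hj]
    · obtain ⟨α, hα, rfl⟩ := cs.exists_isReduced y
      have hd : cs.length (cs.wordProd (α ++ ω) * cs.simple i) <
          cs.length (cs.wordProd (α ++ ω)) := by
        have := cs.length_mul_simple (cs.wordProd (α ++ ω)) i
        simp only [wordProd_append, wordProd_singleton, List.length_append, List.length_singleton,
          mul_assoc] at *
        omega
      obtain ⟨k, hk, he⟩ := exchange cs (α ++ ω) i hd
      by_cases hka : k < α.length
      · exfalso
        rw [List.eraseIdx_append_of_lt_length hka, wordProd_append, wordProd_append] at he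
        have hm := hy (ω ++ [i] ++ ω.reverse) (by
          intro j hj
          simp at hj
          rcases hj with hj | hj | hj
          · exact hω1 j hj
          · rwa [hj]
          · exact hω1 j hj)
        have : cs.wordProd α * cs.wordProd (ω ++ [i] ++ ω.reverse) =
            cs.wordProd (α.eraseIdx k) := by
          simp only [wordProd_append, wordProd_singleton, wordProd_reverse, ← mul_assoc]
          rw [he]; group
        rw [this, hα.eq] at hm
        have h5 := cs.length_wordProd_le (α.eraseIdx k)
        have h6 := List.length_eraseIdx_add_one hka
        omega
      · rw [List.eraseIdx_append_of_length_le (by omega), wordProd_append, wordProd_append,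
          mul_assoc] at he
        have hk2 : k - α.length < ω.length := by simp at hk; omega
        refine ⟨ω.eraseIdx (k - α.length), fun j hj => hω1 j (List.mem_of_mem_eraseIdx hj), ?_, ?_⟩
        · rw [wordProd_append, wordProd_singleton]; exact (mul_left_cancel he).symm
        · have h6 := List.length_eraseIdx_add_one hk2
          simp; omega

/-- Existence of a word with additive length over a minimal element. -/
lemma exists_add (J : Set B) (y : W)
    (hy : ∀ ω : List B, (∀ i ∈ ω, i ∈ J) → cs.length y ≤ cs.length (y * cs.wordProd ω))
    (n : ℕ) (ω : List B) (hn : ω.length = n) (hω : ∀ i ∈ ω, i ∈ J) :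
    ∃ ω' : List B, (∀ i ∈ ω', i ∈ J) ∧ cs.wordProd ω' = cs.wordProd ω ∧
      cs.length (y * cs.wordProd ω) = cs.length y + ω'.length := by
  induction n using Nat.strong_induction_on generalizing ω with
  | _ n ih =>
    by_cases hc : cs.length (y * cs.wordProd ω) < cs.length y + ω.length
    · obtain ⟨ω1, h1, h2, h3⟩ := shorten cs J y hy ω hω hc
      obtain ⟨ω', h4, h5, h6⟩ := ih ω1.length (by omega) ω1 rfl h1
      exact ⟨ω', h4, h5.trans h2, by rw [← h2, h6]⟩
    · refine ⟨ω, hω, rfl, ?_⟩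
      have h1 := cs.length_mul_le y (cs.wordProd ω)
      have h2 := cs.length_wordProd_le ω
      omega

lemma strict_word (J : Set B) (y : W) (hd : ∀ i ∈ J, ¬ cs.IsRightDescent y i)
    (ω : List B) (hω : ∀ i ∈ ω, i ∈ J) (hne : cs.wordProd ω ≠ 1) :
    cs.length y < cs.length (y * cs.wordProd ω) := by
  classical
  have hex : ∃ n, ∃ β : List B, (∀ i ∈ β, i ∈ J) ∧ cs.length (y * cs.wordProd β) = n :=
    ⟨_, [], by simp, rfl⟩
  obtain ⟨β, hβ, hβn⟩ := Nat.find_spec hex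
  have hmin : ∀ γ : List B, (∀ i ∈ γ, i ∈ J) →
      cs.length (y * cs.wordProd β) ≤ cs.length (y * cs.wordProd β * cs.wordProd γ) := by
    intro γ hγ
    rw [hβn, mul_assoc, ← wordProd_append]
    apply Nat.find_min' hex
    refine ⟨β ++ γ, ?_, rfl⟩
    intro i hi
    rcases List.mem_append.mp hi with hi | hi
    · exact hβ i hi
    · exact hγ i hi
  obtain ⟨ω', h1, h2, h3⟩ := exists_add cs J (y * cs.wordProd β) hmin _ β.reverse rfl
    (by intro i hi; exact hβ i (by simpa using hi))
  have hy : y * cs.wordProd β * cs.wordProd ω' = y := by rw [h2]; simp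
  rw [← h2, hy] at h3
  have hβ1 : cs.wordProd β = 1 := by
    rcases List.eq_nil_or_concat ω' with h | ⟨L, i, h⟩
    · rw [h] at h2; simpa using h2.symm
    · exfalso
      subst h
      apply hd i (h1 i (by simp))
      have e : y * cs.simple i = y * cs.wordProd β * cs.wordProd L := by
        conv_lhs => rw [← hy]
        simp [wordProd_append, mul_assoc]
      have h4 := cs.length_mul_le (y * cs.wordProd β) (cs.wordProd L)
      have h5 := cs.length_wordProd_le L
      rw [IsRightDescent, e]
      simp at h3
      omega
  rw [hβ1, mul_one] at hmin
  obtain ⟨ω', h1, h2, h3⟩ := exists_add cs J y hmin _ ω rfl hω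
  rw [h3]
  have : ω' ≠ [] := by rintro rfl; exact hne (by simpa using h2.symm)
  have := List.length_pos_iff.mpr this
  omega

lemma strict (i j : B) (y : W) (hi : ¬ cs.IsRightDescent y i) (hj : ¬ cs.IsRightDescent y j)
    (w : W) (hw : w ∈ Subgroup.closure {cs.simple i, cs.simple j}) (hne : w ≠ 1) :
    cs.length y < cs.length (y * w) := by
  have : ∃ ω : List B, (∀ k ∈ ω, k ∈ ({i, j} : Set B)) ∧ cs.wordProd ω = w := by
    induction hw using Subgroup.closure_induction with
    | mem x hx =>
      rcases hx with rfl | rfl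
      · exact ⟨[i], by simp, by simp⟩
      · exact ⟨[j], by simp, by simp⟩
    | one => exact ⟨[], by simp, by simp⟩
    | mul x z _ _ ihx ihz =>
      by_cases hx : x = 1
      · subst hx
        by_cases hz : z = 1
        · exact ⟨[], by simp, by simp [hz]⟩
        · simpa using ihz hz
      · obtain ⟨α, ha, rfl⟩ := ihx hx
        by_cases hz : z = 1
        · exact ⟨α, ha, by simp [hz]⟩
        · obtain ⟨β, hb, rfl⟩ := ihz hz
          refine ⟨α ++ β, ?_, by simp [wordProd_append]⟩
          intro k hk
          rcases List.mem_append.mp hk with hk | hk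
          · exact ha k hk
          · exact hb k hk
    | inv x _ ih =>
      obtain ⟨α, ha, rfl⟩ := ih (by simpa using hne)
      exact ⟨α.reverse, by simpa using ha, by simp⟩
  obtain ⟨ω, h1, rfl⟩ := this
  exact strict_word cs {i, j} y (by rintro k (rfl | rfl) <;> assumption) ω h1 hne

lemma simple_ne
    (hcomp : ∀ s t : B, s ≠ t → 3 ≤ orderOf (cs.simple s * cs.simple t))
    {i j : B} (h : i ≠ j) : cs.simple i ≠ cs.simple j := by
  intro e
  have := hcomp i j h
  rw [e] at this
  simp at this

lemma not_comm
    (hcomp : ∀ s t : B, s ≠ t → 3 ≤ orderOf (cs.simple s * cs.simple t))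
    {i j : B} (h : i ≠ j) :
    cs.simple i * cs.simple j ≠ cs.simple j * cs.simple i := by
  intro e
  have h3 := hcomp i j h
  have : (cs.simple i * cs.simple j) ^ 2 = 1 := by
    rw [pow_two]; nth_rewrite 2 [e]; simp [mul_assoc]
  have := orderOf_le_of_pow_eq_one (by norm_num) this
  omega

lemma two_desc
    (hcomp : ∀ s t : B, s ≠ t → 3 ≤ orderOf (cs.simple s * cs.simple t))
    {i j : B} (h : i ≠ j) (u : W) (hi : cs.IsRightDescent u i)
    (hj : cs.IsRightDescent u j) : cs.IsRightDescent (u * cs.simple i) j := by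
  by_contra hc
  have h1 : ¬ cs.IsRightDescent (u * cs.simple i) i :=
    cs.isRightDescent_iff_not_isRightDescent_mul.mp hi
  have hs := strict cs i j (u * cs.simple i) h1 hc (cs.simple i * cs.simple j)
    (mul_mem (Subgroup.subset_closure (by simp)) (Subgroup.subset_closure (by simp)))
    (by
      intro e
      have := hcomp i j h
      rw [e] at this
      simp at this)
  rw [isRightDescent_iff] at hi hj
  simp only [mul_assoc, simple_mul_simple_cancel_left] at hs
  omega

lemma three_desc
    (hcomp : ∀ s t : B, s ≠ t → 3 ≤ orderOf (cs.simple s * cs.simple t))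
    {i j : B} (h : i ≠ j) (u : W) (hi : cs.IsRightDescent u i)
    (hj : cs.IsRightDescent u j) :
    cs.IsRightDescent (u * cs.simple i * cs.simple j) i := by
  by_contra hc
  have h1 := two_desc cs hcomp h u hi hj
  have h2 := two_desc cs hcomp h.symm u hj hi
  have h3 := cs.isRightDescent_iff_not_isRightDescent_mul.mp h1
  have hs := strict cs i j _ hc h3
    (cs.simple j * cs.simple i * (cs.simple j * cs.simple i))
    (mul_mem (mul_mem (Subgroup.subset_closure (by simp)) (Subgroup.subset_closure (by simp)))
      (mul_mem (Subgroup.subset_closure (by simp)) (Subgroup.subset_closure (by simp))))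
    (by
      intro e
      have h4 := hcomp j i h.symm
      have := orderOf_le_of_pow_eq_one (x := cs.simple j * cs.simple i) (n := 2) (by norm_num)
        (by rw [pow_two]; exact e)
      omega)
  rw [isRightDescent_iff] at hi hj h1 h2
  simp only [mul_assoc, simple_mul_simple_cancel_left] at hs h1 h2
  omega

/-- The forbidden configuration. -/
lemma forbidden
    (hcomp : ∀ s t : B, s ≠ t → 3 ≤ orderOf (cs.simple s * cs.simple t))
    (n : ℕ) : ∀ (y : W) (r s t : B), r ≠ s → r ≠ t → s ≠ t → cs.length y = n →
    cs.IsRightDescent y s → cs.IsRightDescent y t → cs.IsRightDescent (y * cs.simple t) r →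
    False := by
  induction n using Nat.strong_induction_on with
  | _ n ih =>
    intro y r s t hrs hrt hst hn hs ht hr
    have h1 := two_desc cs hcomp hst.symm y ht hs
    have h2 := three_desc cs hcomp hst.symm y ht hs
    have h3 := two_desc cs hcomp hrs.symm _ h1 hr
    have h4 := three_desc cs hcomp hrs.symm _ h1 hr
    refine ih _ ?_ (y * cs.simple t * cs.simple s) s t r hst hrs.symm hrt.symm rfl h2 h3 h4
    rw [isRightDescent_iff] at ht h1
    omega

lemma mem_pair
    (hcomp : ∀ s t : B, s ≠ t → 3 ≤ orderOf (cs.simple s * cs.simple t))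
    {r s t : B} (h : cs.simple r ∈ Subgroup.closure {cs.simple s, cs.simple t}) :
    r = s ∨ r = t := by
  by_contra hc
  push Not at hc
  have nd : ∀ j, r ≠ j → ¬ cs.IsRightDescent (cs.simple r) j := by
    intro j hj hd
    rw [isRightDescent_iff, length_simple] at hd
    have : cs.simple r * cs.simple j = 1 := by
      rw [← cs.length_eq_zero_iff]; omega
    have h3 := hcomp r j hj
    rw [this] at h3
    simp at h3
  have := strict cs s t (cs.simple r) (nd s hc.1) (nd t hc.2) (cs.simple r) h (by
    intro e
    have := cs.length_simple r
    rw [e] at this; simp at this)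
  simp at this

lemma pair_eq
    (hcomp : ∀ s t : B, s ≠ t → 3 ≤ orderOf (cs.simple s * cs.simple t))
    {y : W} {r s t : B} {a : W} (hst : s ≠ t)
    (h1 : ∃ g ∈ Subgroup.closure {cs.simple s, cs.simple t}, a * g = y)
    (h2 : ∃ g ∈ Subgroup.closure {cs.simple s, cs.simple t}, a * g = y * cs.simple r) :
    ∃ q, r ≠ q ∧ (fun g => a * g) '' (Subgroup.closure {cs.simple s, cs.simple t} : Set W) =
      {z | y⁻¹ * z ∈ Subgroup.closure {cs.simple r, cs.simple q}} := by
  obtain ⟨g, hg, rfl⟩ := h1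
  obtain ⟨k, hk, hkk⟩ := h2
  have hr : cs.simple r ∈ Subgroup.closure {cs.simple s, cs.simple t} := by
    have : cs.simple r = g⁻¹ * k := by
      rw [mul_assoc] at hkk
      rw [mul_left_cancel hkk]; group
    rw [this]
    exact mul_mem (inv_mem hg) hk
  have hset : (fun g => a * g) '' (Subgroup.closure {cs.simple s, cs.simple t} : Set W) =
      {z | (a * g)⁻¹ * z ∈ Subgroup.closure {cs.simple s, cs.simple t}} := by
    ext z
    simp only [Set.mem_image, Set.mem_ofPred_eq, SetLike.mem_coe]
    constructor
    · rintro ⟨x, hx, rfl⟩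
      have : (a * g)⁻¹ * (a * x) = g⁻¹ * x := by group
      rw [this]; exact mul_mem (inv_mem hg) hx
    · intro h
      refine ⟨g * ((a * g)⁻¹ * z), mul_mem hg h, by group⟩
  rcases mem_pair cs hcomp hr with rfl | rfl
  · exact ⟨t, hst, hset⟩
  · refine ⟨s, hst.symm, ?_⟩
    rw [hset, Set.pair_comm]

lemma sInf_eq {i j : B} {y x : W} (hx : y⁻¹ * x ∈ Subgroup.closure {cs.simple i, cs.simple j})
    (hi : ¬ cs.IsRightDescent x i) (hj : ¬ cs.IsRightDescent x j) :
    sInf (cs.length '' {z | y⁻¹ * z ∈ Subgroup.closure {cs.simple i, cs.simple j}}) =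
      cs.length x := by
  apply le_antisymm
  · exact Nat.sInf_le ⟨x, hx, rfl⟩
  · apply le_csInf (Set.Nonempty.image _ ⟨x, hx⟩)
    rintro _ ⟨z, hz, rfl⟩
    by_cases h : x⁻¹ * z = 1
    · rw [inv_mul_eq_one] at h; rw [h]
    · have := strict cs i j x hi hj (x⁻¹ * z) (by
        have : x⁻¹ * z = (y⁻¹ * x)⁻¹ * (y⁻¹ * z) := by group
        rw [this]; exact mul_mem (inv_mem hx) hz) h
      simpa using this.le

end ProjAux


/-- **Proposition (projections).** Let `(W, S)` be a `2`-spherical Coxeter system whose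
Coxeter diagram is the complete graph. Let `R = a · ⟨s, t⟩` and `T = b · ⟨u, v⟩` be two
distinct residues of rank `2` such that `P := R ∩ T` is a panel `c · ⟨r⟩`. If
`min {ℓ(x) : x ∈ R} < min {ℓ(x) : x ∈ T}`, then every element of `T` of minimal length in
`T` equals every element of `P` of minimal length in `P`; in particular the minimal-length
element of `T` lies in `P`. -/
theorem proj_eq_of_panel_intersection
    {B : Type*} [Fintype B] {W : Type*} [Group W] {M : CoxeterMatrix B}
    (cs : CoxeterSystem M W)
    (h2sph : ∀ s t : B, orderOf (cs.simple s * cs.simple t) ≠ 0)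
    (hcomp : ∀ s t : B, s ≠ t → 3 ≤ orderOf (cs.simple s * cs.simple t))
    (a b : W) (s t u v : B) (hst : s ≠ t) (huv : u ≠ v)
    (R T : Set W)
    (hR : R = (fun g => a * g) '' (Subgroup.closure {cs.simple s, cs.simple t} : Set W))
    (hT : T = (fun g => b * g) '' (Subgroup.closure {cs.simple u, cs.simple v} : Set W))
    (hRT : R ≠ T)
    (c : W) (r : B)
    (hP : R ∩ T = (fun g => c * g) '' (Subgroup.closure {cs.simple r} : Set W))
    (hmin : sInf (cs.length '' R) < sInf (cs.length '' T)) :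
    ∀ x ∈ T, (∀ z ∈ T, cs.length x ≤ cs.length z) →
      ∀ y ∈ R ∩ T, (∀ z ∈ R ∩ T, cs.length y ≤ cs.length z) → x = y := by
  classical
  intro x hxT hxmin y hy hymin
  obtain ⟨w, hw, hwy⟩ : y ∈ (fun g => c * g) '' (Subgroup.closure {cs.simple r} : Set W) :=
    hP ▸ hy
  have hyr : y * cs.simple r ∈ R ∩ T := by
    rw [hP]
    refine ⟨w * cs.simple r, mul_mem hw (Subgroup.subset_closure (by simp)), ?_⟩
    rw [← hwy]; simp [mul_assoc]
  have hnr : ¬ cs.IsRightDescent y r := by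
    intro h
    exact absurd (hymin _ hyr) (not_le.mpr h)
  have hy1 := hy.1
  have hy2 := hy.2
  have hyr1 := hyr.1
  have hyr2 := hyr.2
  rw [hR] at hy1 hyr1
  rw [hT] at hy2 hyr2
  obtain ⟨p, hp, hRp⟩ := ProjAux.pair_eq cs hcomp hst hy1 hyr1
  obtain ⟨q, hq, hTq⟩ := ProjAux.pair_eq cs hcomp huv hy2 hyr2
  rw [← hR] at hRp
  rw [← hT] at hTq
  have hpq : p ≠ q := by
    rintro rfl
    exact hRT (hRp.trans hTq.symm)
  have hmem : ∀ i j : B, y⁻¹ * y ∈ Subgroup.closure {cs.simple i, cs.simple j} := by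
    intro i j; simp [one_mem]
  have hmem' : ∀ i j : B, y⁻¹ * (y * cs.simple j) ∈
      Subgroup.closure {cs.simple i, cs.simple j} := by
    intro i j
    rw [inv_mul_cancel_left]
    exact Subgroup.subset_closure (by simp)
  by_cases hdq : cs.IsRightDescent y q
  · exfalso
    by_cases hdp : cs.IsRightDescent y p
    · have h1 : ¬ cs.IsRightDescent (y * cs.simple q) r := fun h =>
        ProjAux.forbidden cs hcomp _ y r p q hp hq hpq rfl hdp hdq h
      have h2 : ¬ cs.IsRightDescent (y * cs.simple p) r := fun h =>
        ProjAux.forbidden cs hcomp _ y r q p hq hp hpq.symm rfl hdq hdp h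
      rw [hRp, hTq, ProjAux.sInf_eq cs (hmem' r p) h2
        (cs.isRightDescent_iff_not_isRightDescent_mul.mp hdp),
        ProjAux.sInf_eq cs (hmem' r q) h1
        (cs.isRightDescent_iff_not_isRightDescent_mul.mp hdq)] at hmin
      rw [CoxeterSystem.isRightDescent_iff] at hdp hdq
      omega
    · rw [hRp, ProjAux.sInf_eq cs (hmem r p) hnr hdp] at hmin
      exact absurd (Nat.sInf_le (Set.mem_image_of_mem cs.length hy.2)) (not_le.mpr hmin)
  · by_contra hne
    have hx : y⁻¹ * x ∈ Subgroup.closure {cs.simple r, cs.simple q} := by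
      rw [hTq] at hxT; exact hxT
    have := ProjAux.strict cs r q y hnr hdq (y⁻¹ * x) hx (by
      intro h; rw [inv_mul_eq_one] at h; exact hne h.symm)
    rw [mul_inv_cancel_left] at this
    exact absurd (hxmin y hy.2) (not_le.mpr this)
end

section
/- Let (W,S) be a Coxeter system such that ⟨J⟩ is infinite for every subset J ⊆ S with three elements. Let r₁ ≠ r₂ be two reflections of W (i.e. conjugates of elements of S). Let R = a·⟨s,t⟩ and T = b·⟨u,v⟩ be spherical residues of rank 2 (a,b ∈ W, s ≠ t ∈ S with m_{st} < ∞, u ≠ v ∈ S with m_{uv} < ∞) such that r₁·R = R, r₂·R = R, r₁·T = T and r₂·T = T. Then R = T. -/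
namespace ResidueAux

open CoxeterSystem

variable {B : Type*} {W : Type*} [Group W] {M : CoxeterMatrix B} (cs : CoxeterSystem M W)

open Classical in
/-- The involution of `W × ZMod 2` attached to a simple reflection. -/
noncomputable def sig (i : B) : Equiv.Perm (W × ZMod 2) where
  toFun p := (cs.simple i * p.1 * cs.simple i, p.2 + if p.1 = cs.simple i then 1 else 0)
  invFun p := (cs.simple i * p.1 * cs.simple i, p.2 + if p.1 = cs.simple i then 1 else 0)
  left_inv p := by
    obtain ⟨x, e⟩ := p
    have h : cs.simple i * x * cs.simple i = cs.simple i ↔ x = cs.simple i := by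
      constructor
      · intro h
        have h2 : cs.simple i * x = 1 := mul_eq_right.mp h
        rw [← cs.inv_simple i]
        exact eq_inv_of_mul_eq_one_right h2
      · rintro rfl; simp
    ext
    · simp [mul_assoc]
    · simp only [h]
      split_ifs
      · rw [add_assoc, (by decide : (1 + 1 : ZMod 2) = 0), add_zero]
      · simp
  right_inv p := by
    obtain ⟨x, e⟩ := p
    have h : cs.simple i * x * cs.simple i = cs.simple i ↔ x = cs.simple i := by
      constructor
      · intro h
        have h2 : cs.simple i * x = 1 := mul_eq_right.mp h
        rw [← cs.inv_simple i]
        exact eq_inv_of_mul_eq_one_right h2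
      · rintro rfl; simp
    ext
    · simp [mul_assoc]
    · simp only [h]
      split_ifs
      · rw [add_assoc, (by decide : (1 + 1 : ZMod 2) = 0), add_zero]
      · simp

open Classical in
theorem sig_apply (i : B) (x : W) (e : ZMod 2) : sig cs i (x, e) =
    (cs.simple i * x * cs.simple i, e + if x = cs.simple i then 1 else 0) := rfl

open Classical in
theorem sig_pow (i j : B) (k : ℕ) (x : W) (e : ZMod 2) :
    ((sig cs i * sig cs j) ^ k) (x, e) =
      ((cs.simple i * cs.simple j) ^ k * x * ((cs.simple i * cs.simple j) ^ k)⁻¹,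
        e + ∑ l ∈ Finset.range (2 * k),
          if x = (cs.simple j * cs.simple i) ^ l * cs.simple j then 1 else 0) := by
  induction k with
  | zero => simp
  | succ k ih =>
    have hinv : ((cs.simple i * cs.simple j) ^ k)⁻¹ = (cs.simple j * cs.simple i) ^ k := by
      rw [← inv_pow]; simp
    have hcomm : cs.simple j * (cs.simple i * cs.simple j) ^ k
        = (cs.simple j * cs.simple i) ^ k * cs.simple j := by
      clear ih hinv
      induction k with
      | zero => simp
      | succ k ih => rw [pow_succ, ← mul_assoc, ih, pow_succ]; simp only [mul_assoc]
    have key : ∀ y : W, (cs.simple i * cs.simple j) ^ k * x * ((cs.simple i * cs.simple j) ^ k)⁻¹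
        = y ↔ x = (cs.simple j * cs.simple i) ^ k * y * (cs.simple i * cs.simple j) ^ k := by
      intro y
      rw [← hinv]
      constructor
      · rintro rfl; group
      · rintro rfl; group
    have h1 : (cs.simple i * cs.simple j) ^ k * x * ((cs.simple i * cs.simple j) ^ k)⁻¹
        = cs.simple j ↔ x = (cs.simple j * cs.simple i) ^ (2 * k) * cs.simple j := by
      rw [key, mul_assoc, hcomm, ← mul_assoc, ← pow_add, two_mul]
    have h2 : cs.simple j * ((cs.simple i * cs.simple j) ^ k * x *
        ((cs.simple i * cs.simple j) ^ k)⁻¹) * cs.simple j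
        = cs.simple i ↔ x = (cs.simple j * cs.simple i) ^ (2 * k + 1) * cs.simple j := by
      have : cs.simple j * ((cs.simple i * cs.simple j) ^ k * x *
        ((cs.simple i * cs.simple j) ^ k)⁻¹) * cs.simple j
        = cs.simple i ↔ (cs.simple i * cs.simple j) ^ k * x *
        ((cs.simple i * cs.simple j) ^ k)⁻¹ = cs.simple j * cs.simple i * cs.simple j := by
        constructor
        · generalize (cs.simple i * cs.simple j) ^ k * x * ((cs.simple i * cs.simple j) ^ k)⁻¹ = q
          intro h; rw [← h]; simp [mul_assoc]
        · intro h; rw [h]; simp [mul_assoc]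
      rw [this, key]
      have : (cs.simple j * cs.simple i) ^ k * (cs.simple j * cs.simple i * cs.simple j) *
          (cs.simple i * cs.simple j) ^ k = (cs.simple j * cs.simple i) ^ (2 * k + 1) * cs.simple j := by
        rw [mul_assoc, mul_assoc (cs.simple j * cs.simple i), hcomm, two_mul, add_assoc, pow_add,
          pow_succ' _ k]
        simp only [mul_assoc]
      rw [this]
    rw [pow_succ', Equiv.Perm.mul_apply, ih, Equiv.Perm.mul_apply, sig_apply, sig_apply]
    ext
    · simp only
      rw [pow_succ']
      simp [mul_assoc]
    · simp only [h1, h2]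
      rw [mul_add, mul_one, Finset.sum_range_succ, Finset.sum_range_succ]
      simp only [add_assoc]

theorem sig_liftable : M.IsLiftable (sig cs) := by
  classical
  intro i j
  ext1 ⟨x, e⟩
  rw [sig_pow]
  have hji : (cs.simple j * cs.simple i) ^ M i j = 1 := by
    rw [M.symmetric i j]; exact cs.simple_mul_simple_pow j i
  ext
  · simp
  · simp only [Equiv.Perm.coe_one, id_eq]
    rw [two_mul, Finset.sum_range_add]
    simp only [pow_add, hji, one_mul]
    rw [CharTwo.add_self_eq_zero, add_zero]

noncomputable def Phi : W →* Equiv.Perm (W × ZMod 2) := cs.lift ⟨sig cs, sig_liftable cs⟩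

theorem Phi_simple (i : B) : Phi cs (cs.simple i) = sig cs i := cs.lift_apply_simple _ _

noncomputable def eta (w x : W) : ZMod 2 := (Phi cs w (x, 0)).2

open Classical in
theorem Phi_word (ω : List B) (x : W) (e : ZMod 2) :
    Phi cs (cs.wordProd ω) (x, e) = (cs.wordProd ω * x * (cs.wordProd ω)⁻¹,
      e + ((cs.rightInvSeq ω).count x : ZMod 2)) := by
  induction ω with
  | nil => simp
  | cons i ω ih =>
    rw [cs.wordProd_cons, map_mul, Equiv.Perm.mul_apply, ih, Phi_simple, sig_apply]
    have h : cs.wordProd ω * x * (cs.wordProd ω)⁻¹ = cs.simple i ↔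
        (cs.wordProd ω)⁻¹ * cs.simple i * cs.wordProd ω = x := by
      constructor
      · intro h; rw [← h]; group
      · rintro rfl; group
    ext
    · simp [mul_assoc]
    · simp only [h, rightInvSeq, List.count_cons, beq_iff_eq]
      split_ifs <;> simp [add_assoc]

open Classical in
theorem eta_word (ω : List B) (x : W) :
    eta cs (cs.wordProd ω) x = ((cs.rightInvSeq ω).count x : ZMod 2) := by
  simp [eta, Phi_word]

theorem Phi_apply (w x : W) (e : ZMod 2) : Phi cs w (x, e) = (w * x * w⁻¹, e + eta cs w x) := by
  classical
  obtain ⟨ω, rfl⟩ := cs.wordProd_surjective w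
  rw [Phi_word, eta_word]

theorem eta_mul (w₁ w₂ x : W) :
    eta cs (w₁ * w₂) x = eta cs w₂ x + eta cs w₁ (w₂ * x * w₂⁻¹) := by
  conv_lhs => rw [eta, map_mul, Equiv.Perm.mul_apply, Phi_apply, Phi_apply]
  simp

theorem eta_one (x : W) : eta cs 1 x = 0 := by simp [eta]

open Classical in
theorem eta_simple (i : B) (x : W) :
    eta cs (cs.simple i) x = if x = cs.simple i then 1 else 0 := by
  simp [eta, Phi_simple, sig_apply]

theorem eta_refl {t : W} (ht : cs.IsReflection t) : eta cs t t = 1 := by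
  obtain ⟨w, i, rfl⟩ := ht
  have h0 := eta_mul cs w w⁻¹ (w * cs.simple i * w⁻¹)
  have h1 := eta_mul cs (w * cs.simple i) w⁻¹ (w * cs.simple i * w⁻¹)
  have e : w⁻¹ * (w * cs.simple i * w⁻¹) * w⁻¹⁻¹ = cs.simple i := by group
  rw [e] at h0 h1
  rw [eta_mul cs w (cs.simple i)] at h1
  have e2 : cs.simple i * cs.simple i * (cs.simple i)⁻¹ = cs.simple i := by group
  rw [e2, eta_simple, if_pos rfl] at h1
  rw [mul_inv_cancel, eta_one] at h0
  rw [h1, add_left_comm, ← h0, add_zero]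

theorem mem_ris_of_eta {ω : List B} {t : W} (h : eta cs (cs.wordProd ω) t ≠ 0) :
    t ∈ cs.rightInvSeq ω := by
  classical
  rw [eta_word] at h
  by_contra hn
  exact h (by rw [List.count_eq_zero_of_not_mem hn]; simp)

theorem lt_of_eta {w t : W} (h : eta cs w t ≠ 0) : cs.length (w * t) < cs.length w := by
  obtain ⟨ω, hω, rfl⟩ := cs.exists_isReduced w
  exact (cs.isRightInversion_of_mem_rightInvSeq hω (mem_ris_of_eta cs h)).2

theorem lt_iff {w t : W} (ht : cs.IsReflection t) :
    cs.length (w * t) < cs.length w ↔ eta cs w t = 1 := by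
  constructor
  · intro h
    by_contra hn
    have h0 : eta cs w t = 0 := by
      revert hn; generalize eta cs w t = z; revert z; decide
    have h1 : eta cs (w * t) t = 1 := by
      rw [eta_mul, eta_refl cs ht, mul_inv_cancel_right, h0, add_zero]
    have := lt_of_eta cs (w := w * t) (t := t) (by rw [h1]; decide)
    rw [mul_assoc, ht.mul_self, mul_one] at this
    omega
  · intro h
    exact lt_of_eta cs (by rw [h]; decide)

theorem eta_eq_zero_of_le {w t : W} (h : cs.length w ≤ cs.length (w * t)) : eta cs w t = 0 := by
  by_contra hn
  have := lt_of_eta cs hn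
  omega

/-- The standard parabolic subgroup. -/
def H (J : Set B) : Subgroup W := Subgroup.closure (cs.simple '' J)

theorem simple_mem {J : Set B} {i : B} (h : i ∈ J) : cs.simple i ∈ H cs J :=
  Subgroup.subset_closure ⟨i, h, rfl⟩

theorem inv_mem_H {J : Set B} {w : W} (hw : w ∈ H cs J) :
    ∀ x, eta cs w x ≠ 0 → x ∈ H cs J := by
  classical
  induction hw using Subgroup.closure_induction with
  | mem w hw =>
    obtain ⟨i, hi, rfl⟩ := hw
    intro x hx
    rw [eta_simple] at hx
    have : x = cs.simple i := by by_contra hn; simp [hn] at hx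
    rw [this]; exact simple_mem cs hi
  | one => intro x hx; exact absurd (eta_one cs x) hx
  | mul w₁ w₂ h₁ h₂ ih₁ ih₂ =>
    intro x hx
    rw [eta_mul] at hx
    by_cases h : eta cs w₂ x = 0
    · rw [h, zero_add] at hx
      have := ih₁ _ hx
      have h3 := (H cs J).mul_mem ((H cs J).mul_mem ((H cs J).inv_mem h₂) this) h₂
      have e : w₂⁻¹ * (w₂ * x * w₂⁻¹) * w₂ = x := by group
      rwa [e] at h3
    · exact ih₂ _ h
  | inv w h ih =>
    intro x hx
    have h0 := eta_mul cs w w⁻¹ x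
    rw [mul_inv_cancel, eta_one] at h0
    have h1 : eta cs w (w⁻¹ * x * w⁻¹⁻¹) ≠ 0 := by
      intro h2; rw [h2, add_zero] at h0; exact hx h0.symm
    have := ih _ h1
    have h3 := (H cs J).mul_mem ((H cs J).mul_mem h this) ((H cs J).inv_mem h)
    have e : w * (w⁻¹ * x * w⁻¹⁻¹) * w⁻¹ = x := by group
    rwa [e] at h3

theorem exists_word {J : Set B} {w : W} (hw : w ∈ H cs J) :
    ∃ ω : List B, (∀ i ∈ ω, i ∈ J) ∧ cs.IsReduced ω ∧ cs.wordProd ω = w := by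
  have step : ∀ (w : W) (i : B), i ∈ J →
      (∃ ω : List B, (∀ i ∈ ω, i ∈ J) ∧ cs.IsReduced ω ∧ cs.wordProd ω = w) →
      ∃ ω : List B, (∀ i ∈ ω, i ∈ J) ∧ cs.IsReduced ω ∧ cs.wordProd ω = w * cs.simple i := by
    rintro w i hi ⟨ω, h1, h2, rfl⟩
    rcases cs.length_mul_simple (cs.wordProd ω) i with h | h
    · refine ⟨ω ++ [i], ?_, ?_, ?_⟩
      · intro j hj
        rcases List.mem_append.mp hj with hj | hj
        · exact h1 j hj
        · rw [List.mem_singleton.mp hj]; exact hi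
      · rw [CoxeterSystem.IsReduced, cs.wordProd_append, cs.wordProd_singleton, h, h2.eq]; simp
      · rw [cs.wordProd_append, cs.wordProd_singleton]
    · have he : eta cs (cs.wordProd ω) (cs.simple i) = 1 :=
        (lt_iff cs (cs.isReflection_simple i)).mp (by omega)
      have hm := mem_ris_of_eta cs (by rw [he]; decide)
      obtain ⟨j, hj, hj2⟩ := List.mem_iff_getElem.mp hm
      have h3 := cs.wordProd_mul_getD_rightInvSeq ω j
      rw [List.getD_eq_getElem _ _ hj, hj2] at h3
      refine ⟨ω.eraseIdx j, ?_, ?_, h3.symm⟩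
      · intro k hk
        exact h1 k (List.mem_of_mem_eraseIdx hk)
      · rw [cs.length_rightInvSeq] at hj
        rw [CoxeterSystem.IsReduced, ← h3, List.length_eraseIdx_of_lt hj]
        have := h2.eq
        omega
  unfold H at hw
  induction hw using Subgroup.closure_induction_right with
  | one => exact ⟨[], by simp, by simp [CoxeterSystem.IsReduced], by simp⟩
  | mul_right x hx y hy ih =>
    obtain ⟨i, hi, rfl⟩ := hy
    exact step _ i hi ih
  | mul_inv_cancel x hx y hy ih =>
    obtain ⟨i, hi, rfl⟩ := hy
    rw [cs.inv_simple]
    exact step _ i hi ih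

theorem exists_descent {J : Set B} {w : W} (hw : w ∈ H cs J) (h1 : w ≠ 1) :
    ∃ i ∈ J, cs.length (w * cs.simple i) < cs.length w := by
  obtain ⟨ω, hJ, hr, rfl⟩ := exists_word cs hw
  have hne : ω ≠ [] := by rintro rfl; simp at h1
  obtain ⟨ω', i, rfl⟩ := List.eq_nil_or_concat' ω |>.resolve_left hne
  refine ⟨i, hJ i (by simp), ?_⟩
  have h2 := hr.eq
  rw [h2, cs.wordProd_append, cs.wordProd_singleton, cs.simple_mul_simple_cancel_right]
  have := cs.length_wordProd_le ω'
  simp; omega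

theorem length_add_le {J : Set B} {g : W}
    (hg : ∀ i ∈ J, eta cs g (cs.simple i) = 1) :
    ∀ (n : ℕ) (w : W), cs.length w = n → w ∈ H cs J →
      cs.length (g * w⁻¹) + cs.length w ≤ cs.length g := by
  intro n
  induction n using Nat.strong_induction_on with
  | _ n ih =>
    intro w hn hw
    by_cases h1 : w = 1
    · subst h1; simp
    obtain ⟨i, hi, hlt⟩ := exists_descent cs hw h1
    have hw' := (H cs J).mul_mem hw (simple_mem cs hi)
    have h2 := ih _ (hn ▸ hlt) _ rfl hw'
    set w' := w * cs.simple i with hw'def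
    have hww : w = w' * cs.simple i := by simp [hw'def]
    have h3 : eta cs w' (cs.simple i) = 0 := eta_eq_zero_of_le cs (by rw [← hww]; omega)
    have h4 := eta_mul cs (g * w'⁻¹) w' (cs.simple i)
    rw [inv_mul_cancel_right, hg i hi, h3, zero_add] at h4
    have h5 := lt_of_eta cs (w := g * w'⁻¹) (by rw [← h4]; decide)
    have e : g * w'⁻¹ * (w' * cs.simple i * w'⁻¹) = g * w⁻¹ := by
      have : w⁻¹ = cs.simple i * w'⁻¹ := by rw [hww, mul_inv_rev, cs.inv_simple]
      rw [this]; simp only [mul_assoc, inv_mul_cancel_left]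
    rw [e] at h5
    have h6 := cs.length_mul_simple w i
    rw [← hw'def] at h6
    omega

theorem finite_length_le [Finite B] (n : ℕ) : {w : W | cs.length w ≤ n}.Finite := by
  refine ((List.finite_length_le B n).image cs.wordProd).subset ?_
  intro w hw
  obtain ⟨ω, hω, rfl⟩ := cs.exists_isReduced w
  exact ⟨ω, by simpa [hω.eq] using hw, rfl⟩

theorem H_finite [Finite B] {J : Set B} {g : W}
    (hg : ∀ i ∈ J, eta cs g (cs.simple i) = 1) : (H cs J : Set W).Finite := by
  refine (finite_length_le cs (cs.length g)).subset ?_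
  intro w hw
  have := length_add_le cs hg _ w rfl hw
  show cs.length w ≤ _
  omega

theorem dihedral_finite {u v : B} (h : orderOf (cs.simple u * cs.simple v) ≠ 0) :
    (H cs {u, v} : Set W).Finite := by
  set z := cs.simple u * cs.simple v with hz
  have hZ : (Subgroup.zpowers z : Set W).Finite := by
    have : IsOfFinOrder z := orderOf_pos_iff.mp (Nat.pos_of_ne_zero h)
    exact finite_zpowers.mpr this
  have hconj : ∀ k : ℤ, z ^ k * cs.simple u = cs.simple u * z ^ (-k) := by
    intro k
    have h1 : cs.simple u * z * (cs.simple u)⁻¹ = z⁻¹ := by simp [hz]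
    have h2 : cs.simple u * z ^ (-k) * (cs.simple u)⁻¹ = z ^ k := by
      rw [← conj_zpow, h1]; simp
    rw [← h2]; simp
  refine (hZ.union (hZ.image (fun x => cs.simple u * x))).subset ?_
  intro w hw
  have hu : ∀ w, w ∈ (Subgroup.zpowers z : Set W) ∪ (fun x => cs.simple u * x) ''
      (Subgroup.zpowers z : Set W) → w * cs.simple u ∈ (Subgroup.zpowers z : Set W) ∪
      (fun x => cs.simple u * x) '' (Subgroup.zpowers z : Set W) := by
    rintro w (⟨k, rfl⟩ | ⟨_, ⟨k, rfl⟩, rfl⟩)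
    · exact Or.inr ⟨z ^ (-k), ⟨-k, rfl⟩, (hconj k).symm⟩
    · refine Or.inl ⟨-k, ?_⟩
      show z ^ (-k) = cs.simple u * z ^ k * cs.simple u
      rw [mul_assoc, hconj]; simp
  have hzz : ∀ w, w ∈ (Subgroup.zpowers z : Set W) ∪ (fun x => cs.simple u * x) ''
      (Subgroup.zpowers z : Set W) → w * z ∈ (Subgroup.zpowers z : Set W) ∪
      (fun x => cs.simple u * x) '' (Subgroup.zpowers z : Set W) := by
    rintro w (⟨k, rfl⟩ | ⟨_, ⟨k, rfl⟩, rfl⟩)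
    · exact Or.inl ⟨k + 1, zpow_add_one z k⟩
    · refine Or.inr ⟨z ^ (k + 1), ⟨k + 1, rfl⟩, ?_⟩
      show cs.simple u * z ^ (k + 1) = cs.simple u * z ^ k * z
      rw [zpow_add_one, mul_assoc]
  have step : ∀ (w : W) (i : B), i ∈ ({u, v} : Set B) →
      w ∈ (Subgroup.zpowers z : Set W) ∪ (fun x => cs.simple u * x) ''
      (Subgroup.zpowers z : Set W) → w * cs.simple i ∈ (Subgroup.zpowers z : Set W) ∪
      (fun x => cs.simple u * x) '' (Subgroup.zpowers z : Set W) := by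
    rintro w i (rfl | hi) hw
    · exact hu w hw
    · rw [Set.mem_singleton_iff] at hi
      subst hi
      have := hzz _ (hu w hw)
      rwa [hz, mul_assoc, cs.simple_mul_simple_cancel_left] at this
  have hw' : w ∈ Subgroup.closure (cs.simple '' {u, v}) := hw
  induction hw' using Subgroup.closure_induction_right with
  | one => exact Or.inl ⟨0, by simp⟩
  | mul_right x hx y hy ih =>
    obtain ⟨i, hi, rfl⟩ := hy
    exact step _ i hi (ih hx)
  | mul_inv_cancel x hx y hy ih =>
    obtain ⟨i, hi, rfl⟩ := hy
    rw [cs.inv_simple]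
    exact step _ i hi (ih hx)

theorem eta_min {G : Subgroup W} {d : W} (hd : ∀ q ∈ G, cs.length d ≤ cs.length (d * q))
    {x : W} (hx : x ∈ G) : eta cs d x = 0 :=
  eta_eq_zero_of_le cs (hd x hx)

/-- The Kilmoyer step. -/
theorem kil_step {J J' : Set B} {d k : W}
    (hd : ∀ q ∈ H cs J, cs.length d ≤ cs.length (d * q))
    (hk : k ∈ H cs J) (hk' : d * k * d⁻¹ ∈ H cs J') {i : B} (hi : i ∈ J)
    (hlt : cs.length (k * cs.simple i) < cs.length k) :
    d * cs.simple i * d⁻¹ ∈ H cs J' := by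
  have h1 : eta cs (d * k) (cs.simple i) = 1 := by
    rw [eta_mul, eta_min cs hd ((H cs J).mul_mem ((H cs J).mul_mem hk (simple_mem cs hi))
      ((H cs J).inv_mem hk)), add_zero]
    exact (lt_iff cs (cs.isReflection_simple i)).mp hlt
  have h2 := eta_mul cs (d * k * d⁻¹) d (cs.simple i)
  rw [inv_mul_cancel_right, h1, eta_min cs hd (simple_mem cs hi), zero_add] at h2
  exact inv_mem_H cs hk' _ (by rw [← h2]; decide)

theorem kil_one {J' : Set B} {u v : B} {d k₁ k₂ : W}
    (hd : ∀ q ∈ H cs {u, v}, cs.length d ≤ cs.length (d * q))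
    (h1 : k₁ ∈ H cs {u, v}) (h2 : k₂ ∈ H cs {u, v})
    (h1' : d * k₁ * d⁻¹ ∈ H cs J') (h2' : d * k₂ * d⁻¹ ∈ H cs J')
    (n1 : k₁ ≠ 1) (n2 : k₂ ≠ 1) (hne : k₁ ≠ k₂) :
    d * cs.simple u * d⁻¹ ∈ H cs J' := by
  by_contra hn
  have aux : ∀ k, k ∈ H cs {u, v} → d * k * d⁻¹ ∈ H cs J' → k ≠ 1 →
      cs.length (k * cs.simple v) < cs.length k ∧ d * cs.simple v * d⁻¹ ∈ H cs J' := by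
    intro k hk hk' hk1
    obtain ⟨i, hi, hlt⟩ := exists_descent cs hk hk1
    have := kil_step cs hd hk hk' hi hlt
    rcases hi with rfl | hi
    · exact absurd this hn
    · rw [Set.mem_singleton_iff] at hi
      subst hi
      exact ⟨hlt, this⟩
  have key : ∀ k, k ∈ H cs {u, v} → d * k * d⁻¹ ∈ H cs J' → k ≠ 1 → k = cs.simple v := by
    intro k hk hk' hk1
    obtain ⟨a1, a2⟩ := aux k hk hk' hk1
    by_contra hkv
    have b1 : k * cs.simple v ≠ 1 := by
      intro h
      apply hkv
      rw [← cs.inv_simple v]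
      exact eq_inv_of_mul_eq_one_left h
    have b2 := (aux (k * cs.simple v) ((H cs _).mul_mem hk (simple_mem cs (by simp)))
      (by
        have := (H cs J').mul_mem hk' a2
        have e : d * k * d⁻¹ * (d * cs.simple v * d⁻¹) = d * (k * cs.simple v) * d⁻¹ := by group
        rwa [e] at this) b1).1
    rw [cs.simple_mul_simple_cancel_right] at b2
    omega
  exact hne ((key _ h1 h1' n1).trans (key _ h2 h2' n2).symm)

theorem kil {J' : Set B} {u v : B} {d k₁ k₂ : W}
    (hd : ∀ q ∈ H cs {u, v}, cs.length d ≤ cs.length (d * q))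
    (h1 : k₁ ∈ H cs {u, v}) (h2 : k₂ ∈ H cs {u, v})
    (h1' : d * k₁ * d⁻¹ ∈ H cs J') (h2' : d * k₂ * d⁻¹ ∈ H cs J')
    (n1 : k₁ ≠ 1) (n2 : k₂ ≠ 1) (hne : k₁ ≠ k₂) :
    ∀ k ∈ H cs {u, v}, d * k * d⁻¹ ∈ H cs J' := by
  have hu := kil_one cs hd h1 h2 h1' h2' n1 n2 hne
  have hv : d * cs.simple v * d⁻¹ ∈ H cs J' := by
    rw [Set.pair_comm] at hd h1 h2
    exact kil_one cs hd h1 h2 h1' h2' n1 n2 hne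
  have : H cs {u, v} ≤ (H cs J').comap (MulAut.conj d).toMonoidHom := by
    unfold H
    rw [Subgroup.closure_le]
    rintro _ ⟨i, (rfl | hi), rfl⟩
    · exact hu
    · rw [Set.mem_singleton_iff] at hi
      subst hi
      exact hv
  exact fun k hk => this hk

theorem d_eq_one [Fintype B] (hinf : ∀ J : Finset B, J.card = 3 →
      (Subgroup.closure (cs.simple '' (J : Set B)) : Set W).Infinite)
    {s t u v : B} (huv : u ≠ v) {d : W}
    (huvfin : orderOf (cs.simple u * cs.simple v) ≠ 0)
    (hd : ∀ q ∈ H cs {u, v}, cs.length d ≤ cs.length (d * q))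
    (h1 : ∀ k ∈ H cs {u, v}, d * k * d⁻¹ ∈ H cs {s, t})
    (h2 : ∀ k ∈ H cs {s, t}, d⁻¹ * k * d ∈ H cs {u, v}) : d = 1 := by
  classical
  by_contra hne
  obtain ⟨x, hx⟩ := cs.exists_rightDescent_of_ne_one hne
  have hxlt : cs.length (d * cs.simple x) < cs.length d := hx
  have hxn : cs.simple x ∉ H cs {u, v} := by
    intro h
    have := hd _ h
    omega
  have hxu : u ≠ x := by rintro rfl; exact hxn (simple_mem cs (by simp))
  have hxv : v ≠ x := by rintro rfl; exact hxn (simple_mem cs (by simp))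
  obtain ⟨w0, hw0, hmax⟩ := Set.exists_max_image _ cs.length (dihedral_finite cs huvfin)
    ⟨1, (H cs {u, v}).one_mem⟩
  have hq : ∀ i ∈ ({u, v} : Set B), eta cs (d * w0) (cs.simple i) = 1 := by
    intro i hi
    rw [eta_mul, eta_min cs hd ((H cs _).mul_mem ((H cs _).mul_mem hw0 (simple_mem cs hi))
      ((H cs _).inv_mem hw0)), add_zero]
    refine (lt_iff cs (cs.isReflection_simple i)).mp ?_
    have a1 := hmax _ ((H cs _).mul_mem hw0 (simple_mem cs hi))
    have a2 := cs.length_mul_simple w0 i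
    omega
  have hqx : eta cs (d * w0) (cs.simple x) = 1 := by
    have a1 := eta_mul cs (d * w0 * d⁻¹) d (cs.simple x)
    rw [inv_mul_cancel_right, (lt_iff cs (cs.isReflection_simple x)).mp hxlt] at a1
    rw [a1]
    have a2 : eta cs (d * w0 * d⁻¹) (d * cs.simple x * d⁻¹) = 0 := by
      by_contra hn
      have a3 := h2 _ (inv_mem_H cs (h1 _ hw0) _ hn)
      have e : d⁻¹ * (d * cs.simple x * d⁻¹) * d = cs.simple x := by group
      rw [e] at a3
      exact hxn a3
    rw [a2, add_zero]
  have hfin : (H cs (({u, v, x} : Finset B) : Set B) : Set W).Finite := by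
    refine H_finite cs (g := d * w0) ?_
    intro i hi
    simp only [Finset.coe_insert, Finset.coe_singleton, Set.mem_insert_iff,
      Set.mem_singleton_iff] at hi
    rcases hi with rfl | rfl | rfl
    · exact hq _ (by simp)
    · exact hq _ (by simp)
    · exact hqx
  exact hinf {u, v, x} (Finset.card_eq_three.mpr ⟨u, v, x, huv, hxu, hxv, rfl⟩) hfin

theorem stab_mem {G : Subgroup W} {r a : W} {R : Set W} (hR : R = (fun g => a * g) '' (G : Set W))
    (h : (fun x => r * x) '' R = R) : a⁻¹ * r * a ∈ G := by
  have h1 : a ∈ R := by rw [hR]; exact ⟨1, G.one_mem, by simp⟩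
  have h2 : r * a ∈ R := by rw [← h]; exact ⟨a, h1, rfl⟩
  rw [hR] at h2
  obtain ⟨g, hg, hg2⟩ := h2
  have hg2 : a * g = r * a := hg2
  have : a⁻¹ * r * a = g := by rw [mul_assoc, ← hg2]; group
  rw [this]; exact hg

theorem main_aux [Fintype B] (hinf : ∀ J : Finset B, J.card = 3 →
      (Subgroup.closure (cs.simple '' (J : Set B)) : Set W).Infinite)
    (r₁ r₂ : W) (hr : r₁ ≠ r₂) (n₁ : r₁ ≠ 1) (n₂ : r₂ ≠ 1)
    (a b : W) (s t u v : B) (huv : u ≠ v)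
    (huvfin : orderOf (cs.simple u * cs.simple v) ≠ 0)
    (h1R : a⁻¹ * r₁ * a ∈ H cs {s, t}) (h2R : a⁻¹ * r₂ * a ∈ H cs {s, t})
    (h1T : b⁻¹ * r₁ * b ∈ H cs {u, v}) (h2T : b⁻¹ * r₂ * b ∈ H cs {u, v}) :
    H cs {s, t} = H cs {u, v} ∧ a⁻¹ * b ∈ H cs {s, t} := by
  classical
  let D : Set W := {d | ∃ p ∈ H cs {s, t}, ∃ q ∈ H cs {u, v}, b = a * p * d * q}
  have hD : D.Nonempty := ⟨a⁻¹ * b, 1, one_mem _, 1, one_mem _, by group⟩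
  obtain ⟨d, ⟨p, hp, q, hq, hb⟩, hmin⟩ := WellFounded.has_min
    (InvImage.wf cs.length Nat.lt_wfRel.wf) D hD
  have hmin : ∀ d' ∈ D, cs.length d ≤ cs.length d' := fun d' h => not_lt.mp (hmin d' h)
  have hd1 : ∀ y ∈ H cs {u, v}, cs.length d ≤ cs.length (d * y) := fun y hy =>
    hmin _ ⟨p, hp, y⁻¹ * q, mul_mem (inv_mem hy) hq, by rw [hb]; group⟩
  have hd2 : ∀ y ∈ H cs {s, t}, cs.length d⁻¹ ≤ cs.length (d⁻¹ * y) := by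
    intro y hy
    rw [← cs.length_inv (d⁻¹ * y), cs.length_inv, mul_inv_rev, inv_inv]
    exact hmin _ ⟨p * y, mul_mem hp hy, q, hq, by rw [hb]; group⟩
  have conjne : ∀ c r : W, r ≠ 1 → c⁻¹ * r * c ≠ 1 := by
    intro c r h h'
    apply h
    have : r = c * (c⁻¹ * r * c) * c⁻¹ := by group
    rw [this, h']; group
  have conjne2 : ∀ c r r' : W, r ≠ r' → c⁻¹ * r * c ≠ c⁻¹ * r' * c := by
    intro c r r' h h'
    exact h (mul_left_cancel (mul_right_cancel h'))
  have hP : ∀ r : W, a⁻¹ * r * a ∈ H cs {s, t} → (a * p)⁻¹ * r * (a * p) ∈ H cs {s, t} := by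
    intro r h
    have e : (a * p)⁻¹ * r * (a * p) = p⁻¹ * (a⁻¹ * r * a) * p := by group
    rw [e]; exact mul_mem (mul_mem (inv_mem hp) h) hp
  have hQ : ∀ r : W, b⁻¹ * r * b ∈ H cs {u, v} →
      (a * p * d)⁻¹ * r * (a * p * d) ∈ H cs {u, v} := by
    intro r h
    have e : (a * p * d)⁻¹ * r * (a * p * d) = q * (b⁻¹ * r * b) * q⁻¹ := by rw [hb]; group
    rw [e]; exact mul_mem (mul_mem hq h) (inv_mem hq)
  have e1 : ∀ r : W, d * ((a * p * d)⁻¹ * r * (a * p * d)) * d⁻¹ = (a * p)⁻¹ * r * (a * p) := by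
    intro r; group
  have e2 : ∀ r : W, d⁻¹ * ((a * p)⁻¹ * r * (a * p)) * d⁻¹⁻¹ =
      (a * p * d)⁻¹ * r * (a * p * d) := by
    intro r; group
  have k1 : ∀ k ∈ H cs {u, v}, d * k * d⁻¹ ∈ H cs {s, t} :=
    kil cs hd1 (hQ _ h1T) (hQ _ h2T) (by rw [e1]; exact hP _ h1R) (by rw [e1]; exact hP _ h2R)
      (conjne _ _ n₁) (conjne _ _ n₂) (conjne2 _ _ _ hr)
  have k2 : ∀ k ∈ H cs {s, t}, d⁻¹ * k * d⁻¹⁻¹ ∈ H cs {u, v} :=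
    kil cs hd2 (hP _ h1R) (hP _ h2R) (by rw [e2]; exact hQ _ h1T) (by rw [e2]; exact hQ _ h2T)
      (conjne _ _ n₁) (conjne _ _ n₂) (conjne2 _ _ _ hr)
  have hd := d_eq_one cs hinf huv huvfin hd1 k1 (by simpa using k2)
  subst hd
  have hEq : H cs {s, t} = H cs {u, v} := by
    ext k
    exact ⟨fun h => by simpa using k2 k h, fun h => by simpa using k1 k h⟩
  refine ⟨hEq, ?_⟩
  have e : a⁻¹ * b = p * q := by rw [hb]; group
  rw [e]
  exact mul_mem hp (hEq ▸ hq)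

end ResidueAux

/-- **Lemma (residues stabilized by two reflections coincide).** Let `(W, S)` be a Coxeter
system such that `⟨J⟩` is infinite for every subset `J ⊆ S` with three elements. Let
`r₁ ≠ r₂` be two reflections of `W` (conjugates of elements of `S`). Let `R = a · ⟨s, t⟩`
and `T = b · ⟨u, v⟩` be spherical residues of rank `2` such that `r₁` and `r₂` both
stabilize `R` and `T` (under left multiplication). Then `R = T`. -/
theorem residue_eq_of_two_reflections_stabilize
    {B : Type*} [Fintype B] {W : Type*} [Group W] {M : CoxeterMatrix B}
    (cs : CoxeterSystem M W)
    (hinf : ∀ J : Finset B, J.card = 3 →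
      (Subgroup.closure (cs.simple '' (J : Set B)) : Set W).Infinite)
    (r₁ r₂ : W) (hr : r₁ ≠ r₂)
    (hr₁ : ∃ (w : W) (s : B), r₁ = w * cs.simple s * w⁻¹)
    (hr₂ : ∃ (w : W) (s : B), r₂ = w * cs.simple s * w⁻¹)
    (a b : W) (s t u v : B) (hst : s ≠ t) (huv : u ≠ v)
    (hstfin : orderOf (cs.simple s * cs.simple t) ≠ 0)
    (huvfin : orderOf (cs.simple u * cs.simple v) ≠ 0)
    (R T : Set W)
    (hR : R = (fun g => a * g) '' (Subgroup.closure {cs.simple s, cs.simple t} : Set W))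
    (hT : T = (fun g => b * g) '' (Subgroup.closure {cs.simple u, cs.simple v} : Set W))
    (h1R : (fun x => r₁ * x) '' R = R) (h2R : (fun x => r₂ * x) '' R = R)
    (h1T : (fun x => r₁ * x) '' T = T) (h2T : (fun x => r₂ * x) '' T = T) :
    R = T := by
  have n₁ : r₁ ≠ 1 := by
    rintro rfl
    have h : cs.IsReflection 1 := hr₁
    simpa using h.odd_length
  have n₂ : r₂ ≠ 1 := by
    rintro rfl
    have h : cs.IsReflection 1 := hr₂
    simpa using h.odd_length
  have hHst : Subgroup.closure {cs.simple s, cs.simple t} = ResidueAux.H cs {s, t} := by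
    rw [ResidueAux.H, Set.image_pair]
  have hHuv : Subgroup.closure {cs.simple u, cs.simple v} = ResidueAux.H cs {u, v} := by
    rw [ResidueAux.H, Set.image_pair]
  rw [hHst] at hR
  rw [hHuv] at hT
  obtain ⟨hEq, hab⟩ := ResidueAux.main_aux cs hinf r₁ r₂ hr n₁ n₂ a b s t u v huv huvfin
    (ResidueAux.stab_mem hR h1R) (ResidueAux.stab_mem hR h2R)
    (ResidueAux.stab_mem hT h1T) (ResidueAux.stab_mem hT h2T)
  rw [hR, hT, ← hEq]
  ext x
  constructor
  · rintro ⟨g, hg, rfl⟩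
    refine ⟨(a⁻¹ * b)⁻¹ * g, mul_mem (inv_mem hab) hg, ?_⟩
    show b * ((a⁻¹ * b)⁻¹ * g) = a * g
    group
  · rintro ⟨g, hg, rfl⟩
    refine ⟨a⁻¹ * b * g, mul_mem hab hg, ?_⟩
    show a * (a⁻¹ * b * g) = b * g
    group
end
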